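/- arXiv:2212.05133 — 2 statements merged into one kernel-verified Lean document; each statement's English description precedes it below -/
import Mathlib

section
/- Let k, t, d be positive integers with 1 ≤ k ≤ k + 2t - 2 ≤ d - 1. Then n(k,d) ≤ 2^{d-t} + ∑_{i=0}^{⌈(k+2t-2)/2⌉} C(d,i). -/
open Finset

/-- Number of coordinates where one string has 0 and the other 1. -/
def Dd {d : ℕ} (x y : Fin d → Option Bool) : ℕ :=
  (univ.filter fun i => ∃ b : Bool, x i = some b ∧ y i = some !b).card

/-- The subcube of binary strings agreeing with `x` on all non-joker coordinates. -/
def Hcube {d : ℕ} (x : Fin d → Option Bool) : Finset (Fin d → Bool) :=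
  univ.filter fun u => ∀ i : Fin d, ∀ b : Bool, x i = some b → u i = b

/-- Number of joker (`*`) coordinates of `x`. -/
def jok {d : ℕ} (x : Fin d → Option Bool) : ℕ :=
  (univ.filter fun i => x i = none).card

/-- `k`-neighborly family of strings in `{0,1,*}^d`. -/
def Nbly {d : ℕ} (k : ℕ) (F : Finset (Fin d → Option Bool)) : Prop :=
  ∀ x ∈ F, ∀ y ∈ F, x ≠ y → 1 ≤ Dd x y ∧ Dd x y ≤ k

/-- `n(k,d)`: maximum size of a `k`-neighborly family in `{0,1,*}^d`. -/
noncomputable def nbox (k d : ℕ) : ℕ :=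
  sSup {n | ∃ F : Finset (Fin d → Option Bool), Nbly k F ∧ F.card = n}

open scoped symmDiff

/-- A map on sets moving only members whose image is not already present. -/
def compressWith (φ : Finset ℕ → Finset ℕ) (F : Finset (Finset ℕ)) (A : Finset ℕ) : Finset ℕ :=
  if φ A ∈ F then A else φ A

/-- If every non-trivial compression preserves `P` and lowers the weight, then there is
a family of the same size satisfying `P` that is stable under all compressions. -/
theorem exists_compressed {ι : Type*} (φ : ι → Finset ℕ → Finset ℕ) (w : Finset ℕ → ℕ)
    (P : Finset (Finset ℕ) → Prop)
    (hinj : ∀ a A B, φ a A ≠ A → φ a B ≠ B → φ a A = φ a B → A = B)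
    (hw : ∀ a A, φ a A ≠ A → w (φ a A) < w A)
    (hP : ∀ a F, P F → P (F.image (compressWith (φ a) F)))
    (F : Finset (Finset ℕ)) (hF : P F) :
    ∃ G, P G ∧ G.card = F.card ∧ ∀ a, ∀ A ∈ G, φ a A ∈ G := by
  induction hm : ∑ A ∈ F, w A using Nat.strong_induction_on generalizing F with
  | _ m ih =>
    by_cases hc : ∀ a, ∀ A ∈ F, φ a A ∈ F
    · exact ⟨F, hF, rfl, hc⟩
    push Not at hc
    obtain ⟨a, A, hA, hAF⟩ := hc
    have hi : Set.InjOn (compressWith (φ a) F) F := by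
      intro B hB C hC h
      simp only [compressWith] at h
      simp only [mem_coe] at hB hC
      split_ifs at h with h1 h2 h2
      · exact h
      · exact absurd (h ▸ hB) h2
      · exact absurd (h ▸ hC) h1
      · exact hinj a B C (fun e => h1 (by rwa [e])) (fun e => h2 (by rwa [e])) h
    have hlt : ∑ B ∈ F.image (compressWith (φ a) F), w B < m := by
      rw [sum_image hi, ← hm]
      refine sum_lt_sum (fun B hB => ?_) ⟨A, hA, ?_⟩
      · simp only [compressWith]
        split_ifs with h
        · exact le_rfl
        · exact (hw a B fun e => h (by rwa [e])).le
      · simp only [compressWith, if_neg hAF]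
        exact hw a A fun e => hAF (by rwa [e])
    obtain ⟨G, hG, hGc, hGs⟩ := ih _ hlt _ (hP a F hF) rfl
    exact ⟨G, hG, hGc.trans (card_image_of_injOn hi), hGs⟩

theorem exists_union_le_of_symmDiff_le {n s : ℕ} (F : Finset (Finset ℕ))
    (hF : ∀ A ∈ F, A ⊆ range n) (hs : ∀ A ∈ F, ∀ B ∈ F, (A ∆ B).card ≤ s) :
    ∃ G : Finset (Finset ℕ), G.card = F.card ∧ (∀ A ∈ G, A ⊆ range n) ∧
      ∀ A ∈ G, ∀ B ∈ G, (A ∪ B).card ≤ s := by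
  obtain ⟨G, ⟨hG, hGs⟩, hc, hd⟩ := exists_compressed (fun i A => A.erase i) card
    (fun F => (∀ A ∈ F, A ⊆ range n) ∧ ∀ A ∈ F, ∀ B ∈ F, (A ∆ B).card ≤ s)
    (by
      intro a A B hA hB h
      have hA : a ∈ A := by by_contra h; exact hA (erase_eq_of_notMem h)
      have hB : a ∈ B := by by_contra h; exact hB (erase_eq_of_notMem h)
      rw [← insert_erase hA, ← insert_erase hB]
      exact congrArg _ h)
    (by
      intro a A hA
      have hA : a ∈ A := by by_contra h; exact hA (erase_eq_of_notMem h)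
      exact card_erase_lt_of_mem hA)
    (by
      rintro i F ⟨hF, hs⟩
      have mixed : ∀ A ∈ F, ∀ B ∈ F, A.erase i ∈ F → (A ∆ B.erase i).card ≤ s := by
        intro A hA B hB hA'
        by_cases h : i ∈ A ∧ i ∈ B
        · refine (card_le_card ?_).trans (hs _ hA' B hB)
          intro x
          simp only [mem_symmDiff, mem_erase]
          grind
        · refine (card_le_card ?_).trans (hs _ hA B hB)
          intro x
          simp only [mem_symmDiff, mem_erase]
          grind
      refine ⟨fun A hfA => ?_, fun A hfA B hfB => ?_⟩
      · obtain ⟨A, hA, rfl⟩ := mem_image.1 hfA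
        simp only [compressWith]
        split_ifs
        · exact hF A hA
        · exact (erase_subset _ _).trans (hF A hA)
      · obtain ⟨A, hA, rfl⟩ := mem_image.1 hfA
        obtain ⟨B, hB, rfl⟩ := mem_image.1 hfB
        simp only [compressWith]
        split_ifs with h1 h2 h2
        · exact hs A hA B hB
        · exact mixed A hA B hB h1
        · rw [symmDiff_comm]
          exact mixed B hB A hA h2
        · refine (card_le_card ?_).trans (hs A hA B hB)
          intro x
          simp only [mem_symmDiff, mem_erase]
          grind)
    F ⟨hF, hs⟩
  refine ⟨G, hc, hG, fun A hA B hB => ?_⟩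
  have key : ∀ C : Finset ℕ, B \ C ∈ G := by
    intro C
    induction C using Finset.induction_on with
    | empty => simpa
    | insert a C _ ih =>
      rw [sdiff_insert]
      exact hd a _ ih
  have := hGs A hA _ (key A)
  rwa [show A ∆ (B \ A) = A ∪ B by ext; simp only [mem_symmDiff, mem_sdiff, mem_union]; tauto]
    at this

/-- Replace `n` by `j` in `A`, when this is possible. -/
def shiftTo (n j : ℕ) (A : Finset ℕ) : Finset ℕ :=
  if n ∈ A ∧ j ∉ A then insert j (A.erase n) else A

theorem exists_shifted {n s : ℕ} (F : Finset (Finset ℕ))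
    (hF : ∀ A ∈ F, A ⊆ range (n + 1)) (hs : ∀ A ∈ F, ∀ B ∈ F, (A ∪ B).card ≤ s) :
    ∃ G : Finset (Finset ℕ), G.card = F.card ∧ (∀ A ∈ G, A ⊆ range (n + 1)) ∧
      (∀ A ∈ G, ∀ B ∈ G, (A ∪ B).card ≤ s) ∧
      ∀ j < n, ∀ A ∈ G, n ∈ A → j ∉ A → insert j (A.erase n) ∈ G := by
  obtain ⟨G, ⟨hG, hGs⟩, hc, hd⟩ := exists_compressed (fun j : Fin n => shiftTo n j)
    (fun A => if n ∈ A then 1 else 0)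
    (fun F => (∀ A ∈ F, A ⊆ range (n + 1)) ∧ ∀ A ∈ F, ∀ B ∈ F, (A ∪ B).card ≤ s)
    (by
      intro j A B hA hB h
      simp only [shiftTo] at hA hB h
      split_ifs at hA hB h with h1 h2
      · ext x
        have := Finset.ext_iff.1 h x
        simp only [mem_insert, mem_erase] at this
        grind
      all_goals contradiction)
    (by
      intro j A hA
      simp only [shiftTo] at hA ⊢
      have := j.2.ne'
      split_ifs at hA ⊢ <;> simp_all)
    (by
      rintro j F ⟨hF, hs⟩
      have hj := j.2
      have swap : ∀ C D : Finset ℕ, n ∈ C → D ⊆ insert ↑j (C.erase n) → C.card ≤ s →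
          D.card ≤ s := by
        intro C D hn hD hC
        refine (card_le_card hD).trans ((card_insert_le _ _).trans ?_)
        rw [card_erase_add_one hn]
        exact hC
      have mixed : ∀ A ∈ F, ∀ B ∈ F, shiftTo n j A ∈ F → shiftTo n j B ∉ F →
          (A ∪ shiftTo n j B).card ≤ s := by
        intro A hA B hB hA' hB'
        simp only [shiftTo] at hA' hB' ⊢
        by_cases hB2 : n ∈ B ∧ ↑j ∉ B
        swap
        · rw [if_neg hB2] at hB'; exact absurd hB hB'
        rw [if_pos hB2]
        by_cases h : n ∈ A ∧ ↑j ∉ A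
        · rw [if_pos h] at hA'
          refine (card_le_card ?_).trans (hs _ hA' B hB)
          intro x
          simp only [mem_union, mem_insert, mem_erase]
          grind
        · by_cases hjA : ↑j ∈ A
          · refine (card_le_card ?_).trans (hs _ hA B hB)
            intro x
            simp only [mem_union, mem_insert, mem_erase]
            grind
          · refine swap (A ∪ B) _ (mem_union_right _ hB2.1) ?_ (hs _ hA B hB)
            intro x
            simp only [mem_union, mem_insert, mem_erase]
            grind
      refine ⟨fun A hfA => ?_, fun A hfA B hfB => ?_⟩
      · obtain ⟨A, hA, rfl⟩ := mem_image.1 hfA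
        simp only [compressWith]
        split_ifs
        · exact hF A hA
        · simp only [shiftTo]
          split_ifs
          · refine insert_subset (mem_range.2 (by omega)) ((erase_subset _ _).trans (hF A hA))
          · exact hF A hA
      · obtain ⟨A, hA, rfl⟩ := mem_image.1 hfA
        obtain ⟨B, hB, rfl⟩ := mem_image.1 hfB
        simp only [compressWith]
        split_ifs with h1 h2 h2
        · exact hs A hA B hB
        · exact mixed A hA B hB h1 h2
        · rw [union_comm]
          exact mixed B hB A hA h2 h1
        · simp only [shiftTo] at h1 h2 ⊢
          split_ifs at h1 h2 ⊢ with hA2 hB2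
          · refine swap (A ∪ B) _ (mem_union_right _ hB2.1) ?_ (hs _ hA B hB)
            intro x
            simp only [mem_union, mem_insert, mem_erase]
            grind
          all_goals contradiction)
    F ⟨hF, hs⟩
  refine ⟨G, hc, hG, hGs, fun j hj A hA hn hjA => ?_⟩
  have := hd ⟨j, hj⟩ A hA
  simpa only [shiftTo, if_pos (And.intro hn hjA)] using this

theorem card_le_two_pow_of_union_le {n : ℕ} (F : Finset (Finset ℕ))
    (hF : ∀ A ∈ F, A ⊆ range (n + 1)) (hs : ∀ A ∈ F, ∀ B ∈ F, (A ∪ B).card ≤ n) :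
    F.card ≤ 2 ^ n := by
  have hi : Set.InjOn (fun A => range (n + 1) \ A) F := by
    intro A hA B hB h
    simp only at h
    rw [← Finset.sdiff_sdiff_eq_self (hF A hA), h, Finset.sdiff_sdiff_eq_self (hF B hB)]
  have hdis : Disjoint F (F.image fun A => range (n + 1) \ A) := by
    rw [disjoint_left]
    intro A hA hA'
    obtain ⟨B, hB, rfl⟩ := mem_image.1 hA'
    have := hs _ hA B hB
    rw [sdiff_union_of_subset (hF B hB), card_range] at this
    omega
  have hsub : F ∪ F.image (fun A => range (n + 1) \ A) ⊆ (range (n + 1)).powerset := by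
    refine union_subset (fun A hA => mem_powerset.2 (hF A hA)) fun A hA => ?_
    obtain ⟨B, -, rfl⟩ := mem_image.1 hA
    exact mem_powerset.2 sdiff_subset
  have := card_le_card hsub
  rw [card_union_of_disjoint hdis, card_image_of_injOn hi, card_powerset, card_range,
    pow_succ] at this
  omega

theorem sum_range_succ_choose_succ (n r : ℕ) :
    ∑ i ∈ range (r + 2), (n + 1).choose i =
      ∑ i ∈ range (r + 2), n.choose i + ∑ i ∈ range (r + 1), n.choose i := by
  rw [sum_range_succ', sum_range_succ' (fun i => n.choose i)]
  simp only [Nat.choose_succ_succ', sum_add_distrib, Nat.choose_zero_right]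
  ring

/-- Katona's theorem in union form, for an even bound. -/
theorem card_le_sum_choose_of_union_le (n : ℕ) : ∀ (r : ℕ) (F : Finset (Finset ℕ)), 2 * r < n →
    (∀ A ∈ F, A ⊆ range n) → (∀ A ∈ F, ∀ B ∈ F, (A ∪ B).card ≤ 2 * r) →
    F.card ≤ ∑ i ∈ range (r + 1), n.choose i := by
  induction n with
  | zero => intro r F h; omega
  | succ n ih =>
    intro r F hr hF hs
    rcases (show 2 * r = n ∨ 2 * r < n by omega) with rfl | hrn
    · refine (card_le_two_pow_of_union_le F hF hs).trans ?_
      rw [Nat.sum_range_choose_halfway, pow_mul]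
      norm_num
    rcases r with _ | r
    · have : F ⊆ {∅} := by
        intro A hA
        have := hs A hA A hA
        simpa using this
      simpa using card_le_card this
    obtain ⟨G, hc, hG, hGs, hsh⟩ := exists_shifted F hF hs
    rw [← hc, sum_range_succ_choose_succ, ← card_filter_add_card_filter_not (fun A => n ∉ A)]
    refine add_le_add (ih (r + 1) _ hrn ?_ ?_) ?_
    · intro A hA x hx
      rw [mem_filter] at hA
      have := mem_range.1 (hG A hA.1 hx)
      have : x ≠ n := fun e => hA.2 (e ▸ hx)
      exact mem_range.2 (by omega)
    · exact fun A hA B hB => hGs A (mem_filter.1 hA).1 B (mem_filter.1 hB).1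
    have hi : Set.InjOn (fun A : Finset ℕ => A.erase n) (G.filter fun A => ¬ n ∉ A) := by
      intro A hA B hB h
      simp only [coe_filter, Set.mem_ofPred_eq, not_not] at hA hB h
      rw [← insert_erase hA.2, h, insert_erase hB.2]
    rw [← card_image_of_injOn hi]
    refine ih r _ (by omega) ?_ ?_
    · intro A hA x hx
      obtain ⟨B, hB, rfl⟩ := mem_image.1 hA
      rw [mem_filter] at hB
      rw [mem_erase] at hx
      have := mem_range.1 (hG B hB.1 hx.2)
      exact mem_range.2 (by omega)
    · intro A hA' B hB'
      obtain ⟨A, hA, rfl⟩ := mem_image.1 hA'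
      obtain ⟨B, hB, rfl⟩ := mem_image.1 hB'
      rw [mem_filter, not_not] at hA hB
      have hAB := hGs A hA.1 B hB.1
      have hnAB : n ∈ A ∪ B := mem_union_left _ hA.2
      obtain ⟨j, hj, hjAB⟩ : ∃ j ∈ range (n + 1), j ∉ A ∪ B := by
        by_contra! h
        have := card_le_card (show range (n + 1) ⊆ A ∪ B from h)
        rw [card_range] at this
        omega
      have hjn : j ≠ n := fun e => hjAB (e ▸ hnAB)
      have hj := mem_range.1 hj
      have hins := hGs _ (hsh j (by omega) A hA.1 hA.2 fun h => hjAB (mem_union_left _ h)) B hB.1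
      have e1 : insert j (A.erase n) ∪ B = insert j (A ∪ B) := by
        ext x
        simp only [mem_union, mem_insert, mem_erase]
        grind
      have e2 : A.erase n ∪ B.erase n = (A ∪ B).erase n := (erase_union_distrib _ _ _).symm
      rw [e1, card_insert_of_notMem hjAB] at hins
      rw [e2, card_erase_of_mem hnAB]
      omega

/-- A form of Kleitman's diameter theorem. -/
theorem card_le_sum_choose_of_symmDiff_le {n s : ℕ} (hsn : s < n) (F : Finset (Finset ℕ))
    (hF : ∀ A ∈ F, A ⊆ range n) (hs : ∀ A ∈ F, ∀ B ∈ F, (A ∆ B).card ≤ s) :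
    F.card ≤ ∑ i ∈ range ((s + 1) / 2 + 1), n.choose i := by
  obtain ⟨G, hc, hG, hGs⟩ := exists_union_le_of_symmDiff_le F hF hs
  rw [← hc]
  by_cases h : 2 * ((s + 1) / 2) < n
  · exact card_le_sum_choose_of_union_le n _ G h hG
      fun A hA B hB => (hGs A hA B hB).trans (by omega)
  · obtain ⟨m, rfl⟩ : ∃ m, s = 2 * m + 1 := ⟨s / 2, by omega⟩
    obtain rfl : n = 2 * m + 1 + 1 := by omega
    refine (card_le_two_pow_of_union_le G hG hGs).trans ?_
    rw [show (2 * m + 1 + 1) / 2 + 1 = m + 2 by omega, sum_range_succ_choose_succ,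
      sum_range_succ, Nat.sum_range_choose_halfway, pow_succ, pow_mul]
    norm_num
    omega

/-- The set of coordinates where a string equals `1`, as a set of naturals. -/
def onesSet {d : ℕ} (x : Fin d → Option Bool) : Finset ℕ :=
  (univ.filter fun i => x i = some true).map Fin.valEmbedding

theorem card_symmDiff_onesSet_le {d : ℕ} (x y : Fin d → Option Bool) :
    (onesSet x ∆ onesSet y).card ≤ Dd x y + jok x + jok y := by
  rw [onesSet, onesSet, map_eq_image, map_eq_image,
    ← image_symmDiff _ _ Fin.valEmbedding.injective, card_image_of_injective _
    Fin.valEmbedding.injective, Dd, jok, jok]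
  refine (card_le_card ?_).trans ((card_union_le _ _).trans
    (Nat.add_le_add_right (card_union_le _ _) _))
  intro i
  simp only [mem_symmDiff, mem_union, mem_filter, mem_univ, true_and]
  rcases x i with _ | _ | _ <;> rcases y i with _ | _ | _ <;> simp

theorem exists_of_one_le_Dd {d : ℕ} {x y : Fin d → Option Bool} (h : 1 ≤ Dd x y) :
    ∃ i b, x i = some b ∧ y i = some !b := by
  obtain ⟨i, hi⟩ := card_pos.1 h
  exact ⟨i, (mem_filter.1 hi).2⟩

theorem onesSet_ne {d : ℕ} {x y : Fin d → Option Bool} (h : 1 ≤ Dd x y) :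
    onesSet x ≠ onesSet y := by
  obtain ⟨i, b, hx, hy⟩ := exists_of_one_le_Dd h
  intro e
  have e := map_injective _ e
  have := Finset.ext_iff.1 e i
  cases b <;> simp [hx, hy] at this

theorem card_Hcube {d : ℕ} (x : Fin d → Option Bool) : (Hcube x).card = 2 ^ jok x := by
  have : Hcube x = Fintype.piFinset fun i => univ.filter fun c => ∀ b, x i = some b → c = b := by
    ext u
    simp [Hcube]
  rw [this, Fintype.card_piFinset, jok, card_filter, ← prod_pow_eq_pow_sum]
  refine prod_congr rfl fun i _ => ?_
  rcases x i with _ | _ | _ <;> simp [filter_eq']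

theorem disjoint_Hcube {d : ℕ} {x y : Fin d → Option Bool} (h : 1 ≤ Dd x y) :
    Disjoint (Hcube x) (Hcube y) := by
  obtain ⟨i, b, hx, hy⟩ := exists_of_one_le_Dd h
  rw [disjoint_left]
  intro u hu hv
  have h1 := (mem_filter.1 hu).2 i b hx
  have h2 := (mem_filter.1 hv).2 i _ hy
  rw [h1] at h2
  cases b <;> simp at h2

theorem card_le_two_pow_of_le_jok {d k t : ℕ} (htd : t ≤ d) {F : Finset (Fin d → Option Bool)}
    (hF : Nbly k F) (hj : ∀ x ∈ F, t ≤ jok x) : F.card ≤ 2 ^ (d - t) := by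
  have h : ∑ x ∈ F, (Hcube x).card ≤ 2 ^ d := by
    rw [← card_biUnion fun x hx y hy hxy => disjoint_Hcube (hF x hx y hy hxy).1]
    exact (card_le_univ _).trans (by simp)
  have h2 : F.card * 2 ^ t ≤ ∑ x ∈ F, (Hcube x).card := by
    rw [← smul_eq_mul]
    refine card_nsmul_le_sum _ _ _ fun x hx => ?_
    rw [card_Hcube]
    exact Nat.pow_le_pow_right two_pos (hj x hx)
  refine Nat.le_of_mul_le_mul_right ?_ (Nat.two_pow_pos t)
  rw [← pow_add, Nat.sub_add_cancel htd]
  exact h2.trans h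

theorem stmt_2 {k t d : ℕ} (hk : 1 ≤ k) (ht : 1 ≤ t)
    (hkd : k + 2 * t - 2 ≤ d - 1) (hd : 1 ≤ d) :
    nbox k d ≤ 2 ^ (d - t) +
      ∑ i ∈ Finset.range ((k + 2 * t - 1) / 2 + 1), d.choose i := by
  refine csSup_le ⟨0, ∅, by simp [Nbly], rfl⟩ ?_
  rintro _ ⟨F, hF, rfl⟩
  rw [← card_filter_add_card_filter_not (s := F) (fun x => t ≤ jok x)]
  refine add_le_add (card_le_two_pow_of_le_jok (k := k) (by omega) ?_ ?_) ?_
  · exact fun x hx y hy => hF x (mem_filter.1 hx).1 y (mem_filter.1 hy).1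
  · exact fun x hx => (mem_filter.1 hx).2
  have hi : Set.InjOn onesSet (SetLike.coe (F.filter fun x => ¬ t ≤ jok x)) := by
    intro x hx y hy h
    by_contra hne
    exact onesSet_ne (hF x (mem_filter.1 hx).1 y (mem_filter.1 hy).1 hne).1 h
  rw [← card_image_of_injOn hi, show k + 2 * t - 1 = k + 2 * t - 2 + 1 by omega]
  refine card_le_sum_choose_of_symmDiff_le (by omega) _ ?_ ?_
  · intro A hA a ha
    obtain ⟨x, -, rfl⟩ := mem_image.1 hA
    obtain ⟨i, -, rfl⟩ := mem_map.1 ha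
    exact mem_range.2 i.2
  · intro A hA B hB
    obtain ⟨x, hx, rfl⟩ := mem_image.1 hA
    obtain ⟨y, hy, rfl⟩ := mem_image.1 hB
    rw [mem_filter] at hx hy
    by_cases hxy : x = y
    · simp [hxy]
    · have h1 := card_symmDiff_onesSet_le x y
      have h2 := (hF x hx.1 y hy.1 hxy).2
      omega
end

section
/- Let F ⊆ {0,1,*}^d be a 2-neighborly partition (i.e., 1 ≤ D(x,y) ≤ 2 for all distinct x,y ∈ F, and the subcubes H(x), x ∈ F, partition {0,1}^d) with |F| ≥ 2. Then F is a lamination: there exists a coordinate i ∈ [d] such that every string in F has a non-joker symbol (0 or 1) at position i. -/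
open Finset

/-- Every finite multigraph, with half-edges `f i false` and `f i true`, has an orientation for which
every vertex carrying two half-edges is both a head and a tail. -/
theorem exists_orientation {ι V : Type*} [DecidableEq ι] (n : ℕ) :
    ∀ (E : Finset ι) (f : ι → Bool → V), E.card = n →
      ∃ u : ι → Bool, ∀ h₁ h₂ : ι × Bool, h₁ ≠ h₂ → h₁.1 ∈ E → h₂.1 ∈ E →
        f h₁.1 h₁.2 = f h₂.1 h₂.2 →
        (∃ i ∈ E, f i (u i) = f h₁.1 h₁.2) ∧ ∃ i ∈ E, f i (!u i) = f h₁.1 h₁.2 := by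
  induction n with
  | zero =>
    intro E f hE
    obtain rfl := Finset.card_eq_zero.mp hE
    exact ⟨fun _ => false, fun h₁ _ _ h => by simp at h⟩
  | succ n ih =>
    intro E f hE
    by_cases hv : ∃ i ∈ E, ∃ j ∈ E, i ≠ j ∧ ∃ s t, f i s = f j t
    · obtain ⟨i, hi, j, hj, hij, s, t, hst⟩ := hv
      set g : ι → Bool → V :=
        Function.update f i (fun b => if b = s then f j (!t) else f i b) with hg
      have gi_s : g i s = f j (!t) := by simp [hg]
      have gi_ns : g i (!s) = f i (!s) := by simp [hg]
      have g_ne : ∀ k, k ≠ i → g k = f k := fun k hk => by simp [hg, hk]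
      obtain ⟨u, hu⟩ := ih (E.erase j) g (by rw [Finset.card_erase_of_mem hj, hE]; rfl)
      set w : ι → Bool := Function.update u j (if u i = s then !t else t) with hw
      have wj : w j = if u i = s then !t else t := by simp [hw]
      have w_ne : ∀ k, k ≠ j → w k = u k := fun k hk => by simp [hw, hk]
      have head : ∀ k ∈ E.erase j, ∃ l ∈ E, f l (w l) = g k (u k) := by
        intro k hk
        rw [Finset.mem_erase] at hk
        by_cases hki : k = i
        · subst hki
          by_cases hus : u k = s
          · exact ⟨j, hj, by rw [wj, if_pos hus, hus, gi_s]⟩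
          · have hus' : u k = !s := by revert hus; cases u k <;> cases s <;> simp
            exact ⟨k, hi, by rw [w_ne k hij, hus', gi_ns]⟩
        · exact ⟨k, hk.2, by rw [w_ne k hk.1, g_ne k hki]⟩
      have tail : ∀ k ∈ E.erase j, ∃ l ∈ E, f l (!w l) = g k (!u k) := by
        intro k hk
        rw [Finset.mem_erase] at hk
        by_cases hki : k = i
        · subst hki
          by_cases hus : u k = s
          · exact ⟨k, hi, by rw [w_ne k hij, hus, gi_ns]⟩
          · have hus' : u k = !s := by revert hus; cases u k <;> cases s <;> simp
            exact ⟨j, hj, by rw [wj, if_neg hus, hus', Bool.not_not, gi_s]⟩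
        · exact ⟨k, hk.2, by rw [w_ne k hk.1, g_ne k hki]⟩
      refine ⟨w, fun h₁ h₂ hne hE₁ hE₂ heq => ?_⟩
      by_cases hvs : f h₁.1 h₁.2 = f i s
      · rw [hvs]
        by_cases hus : u i = s
        · exact ⟨⟨i, hi, by rw [w_ne i hij, hus]⟩,
            ⟨j, hj, by rw [wj, if_pos hus, Bool.not_not, hst]⟩⟩
        · have hus' : u i = !s := by revert hus; cases u i <;> cases s <;> simp
          exact ⟨⟨j, hj, by rw [wj, if_neg hus, hst]⟩,
            ⟨i, hi, by rw [w_ne i hij, hus', Bool.not_not]⟩⟩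
      · let φ : ι × Bool → ι × Bool := fun h => if h.1 = j then (i, s) else h
        have φ_mem : ∀ h : ι × Bool, h.1 ∈ E → (φ h).1 ∈ E.erase j := by
          intro h hh
          by_cases hhj : h.1 = j
          · simp [φ, hhj, hi, hij]
          · simp [φ, hhj, hh]
        have φ_val : ∀ h : ι × Bool, f h.1 h.2 ≠ f i s →
            g (φ h).1 (φ h).2 = f h.1 h.2 := by
          rintro ⟨k, r⟩ hh
          by_cases hkj : k = j
          · subst hkj
            have : r = !t := by
              by_contra hr
              have : r = t := by revert hr; cases r <;> cases t <;> simp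
              exact hh (by simp [this, hst])
            simp [φ, gi_s, this]
          · by_cases hki : k = i
            · subst hki
              have : r = !s := by
                by_contra hr
                have : r = s := by revert hr; cases r <;> cases s <;> simp
                exact hh (by simp [this])
              simp [φ, hkj, gi_ns, this]
            · simp [φ, hkj, g_ne k hki]
        have φ_ne : φ h₁ ≠ φ h₂ := by
          obtain ⟨k₁, r₁⟩ := h₁
          obtain ⟨k₂, r₂⟩ := h₂
          have hvs₂ : f k₂ r₂ ≠ f i s := fun h => hvs (heq.trans h)
          simp only at hvs heq
          by_cases h1 : k₁ = j <;> by_cases h2 : k₂ = j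
          · subst h1 h2
            exfalso
            have e₁ : r₁ ≠ t := fun h => hvs (by rw [h, hst])
            have e₂ : r₂ ≠ t := fun h => hvs₂ (by rw [h, hst])
            apply hne
            revert e₁ e₂
            cases r₁ <;> cases r₂ <;> cases t <;> simp
          · simp only [φ, h1, h2, if_true, if_false]
            rintro h
            rw [Prod.mk.injEq] at h
            exact hvs₂ (by rw [h.1, h.2])
          · simp only [φ, h1, h2, if_true, if_false]
            rintro h
            rw [Prod.mk.injEq] at h
            exact hvs (by rw [h.1, h.2])
          · simpa only [φ, h1, h2, if_false] using hne
        have hvs₂ : f h₂.1 h₂.2 ≠ f i s := fun h => hvs (heq.trans h)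
        obtain ⟨⟨k, hk, hk'⟩, l, hl, hl'⟩ := hu (φ h₁) (φ h₂) φ_ne (φ_mem _ hE₁) (φ_mem _ hE₂)
          (by rw [φ_val _ hvs, φ_val _ hvs₂, heq])
        rw [φ_val _ hvs] at hk' hl'
        obtain ⟨k', hk₁, hk₂⟩ := head k hk
        obtain ⟨l', hl₁, hl₂⟩ := tail l hl
        exact ⟨⟨k', hk₁, hk₂.trans hk'⟩, ⟨l', hl₁, hl₂.trans hl'⟩⟩
    · push Not at hv
      refine ⟨fun _ => false, ?_⟩
      rintro ⟨i, s⟩ ⟨j, t⟩ hne hi hj heq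
      simp only at hi hj heq ⊢
      by_cases hij : i = j
      · subst hij
        have hst : s ≠ t := fun h => hne (by rw [h])
        refine ⟨⟨i, hi, ?_⟩, ⟨i, hi, ?_⟩⟩ <;> revert hst heq <;>
          cases s <;> cases t <;> simp +contextual
      · exact absurd heq (hv i hi j hj hij s t)

/-- Consider `n` loopless edges on `n` vertices, with `B` the set of vertices of degree at least
two, of which there are at most two, and suppose at most two edges lie within `B`. Then exactly two
edges lie within `B`, it has two elements, and there are no isolated vertices. -/
theorem card_eq_two_of_edges {ι : Type*} [Fintype ι] [DecidableEq ι] [Nonempty ι]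
    (f : ι → Bool → ι) (hf : ∀ i, f i false ≠ f i true) (B : Finset ι)
    (hB : ∀ v, v ∈ B ↔ 2 ≤ (univ.filter fun h : ι × Bool => f h.1 h.2 = v).card)
    (hB2 : B.card ≤ 2)
    (hM2 : B.card = 2 → (univ.filter fun i => ∀ s, f i s ∈ B).card ≤ 2) :
    B.card = 2 ∧ (univ.filter fun i => ∀ s, f i s ∈ B).card = 2 ∧
      ∀ j, ∃ k s, f k s = j := by
  set M := univ.filter fun i => ∀ s, f i s ∈ B with hM
  set deg : ι → ℕ := fun v => (univ.filter fun h : ι × Bool => f h.1 h.2 = v).card with hdeg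
  have hsum : ∑ v, deg v = 2 * Fintype.card ι := by
    have := Finset.card_eq_sum_card_fiberwise (s := (univ : Finset (ι × Bool)))
      (t := (univ : Finset ι)) (f := fun h => f h.1 h.2) (by simp)
    simp only [Finset.card_univ, Fintype.card_prod, Fintype.card_bool] at this
    rw [mul_comm] at this
    exact this.symm
  have hsumB : ∑ v ∈ B, deg v ≤ Fintype.card ι + M.card := by
    have h1 : ∑ v ∈ B, deg v = ∑ i, ∑ s, if f i s ∈ B then 1 else 0 := by
      rw [← Fintype.sum_prod_type' (f := fun i s => if f i s ∈ B then 1 else 0)]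
      simp only [hdeg, Finset.card_filter]
      rw [Finset.sum_comm]
      refine Finset.sum_congr rfl fun h _ => ?_
      simp
    have h2 : Fintype.card ι + M.card = ∑ i, (1 + if ∀ s, f i s ∈ B then 1 else 0) := by
      rw [Finset.sum_add_distrib, hM, Finset.card_filter]
      simp
    rw [h1, h2]
    refine Finset.sum_le_sum fun i _ => ?_
    simp only [Fintype.sum_bool, Bool.forall_bool]
    split_ifs <;> simp_all
  have hcompl : ∀ v ∈ Bᶜ, deg v ≤ 1 := by
    intro v hv
    rw [Finset.mem_compl, hB] at hv
    have : ¬ 2 ≤ deg v := hv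
    omega
  have hsumC : ∑ v ∈ Bᶜ, deg v ≤ Bᶜ.card := by
    simpa using Finset.sum_le_sum hcompl
  have hsplit := Finset.sum_add_sum_compl B deg
  have hcardC := Finset.card_add_card_compl B
  have hpos : 0 < Fintype.card ι := Fintype.card_pos
  have hMB : M.Nonempty → B.card = 2 := by
    rintro ⟨i, hi⟩
    have hi' : ∀ s, f i s ∈ B := by simpa [hM] using hi
    have : 1 < B.card := Finset.one_lt_card.mpr ⟨_, hi' false, _, hi' true, hf i⟩
    omega
  have hMpos : M.Nonempty := by
    rw [← Finset.card_pos]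
    by_contra h0
    have hB0 : B = ∅ := by rw [← Finset.card_eq_zero]; omega
    rw [hB0] at hsplit hsumC hcardC
    simp at hsplit hsumC hcardC
    omega
  have hBc := hMB hMpos
  have hMle := hM2 hBc
  refine ⟨hBc, by omega, fun j => ?_⟩
  by_contra! hj
  have hj0 : deg j = 0 := by
    simp only [hdeg, Finset.card_eq_zero]
    ext h
    simp [hj]
  have hjB : j ∈ Bᶜ := by
    rw [Finset.mem_compl, hB]
    change ¬ 2 ≤ deg j
    omega
  have : ∑ v ∈ Bᶜ, deg v < ∑ v ∈ Bᶜ, 1 :=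
    Finset.sum_lt_sum hcompl ⟨j, hjB, by omega⟩
  simp only [Finset.sum_const, smul_eq_mul, mul_one] at this
  omega

/-- If `S u` is the set of fixed coordinates of the part containing `u` in a partition of the cube
into subcubes, any two parts disagreeing in at most two coordinates, then a map `f` such that
`f i s` is a fixed coordinate throughout the half cube `u i = s` gives a coordinate which is fixed
throughout the cube. -/
theorem exists_forall_mem_of_halves {ι : Type*} [Fintype ι] [DecidableEq ι] [Nonempty ι]
    (S : (ι → Bool) → Finset ι)
    (hS : ∀ u v, (∀ i ∈ S u, v i = u i) → S v = S u)
    (hD : ∀ u v, ((S u ∩ S v).filter fun i => u i ≠ v i).card ≤ 2)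
    (f : ι → Bool → ι) (hfi : ∀ i s, f i s ≠ i) (hfS : ∀ u i, f i (u i) ∈ S u) :
    ∃ i, ∀ u, i ∈ S u := by
  by_contra! hno
  have flip : ∀ u i b, i ∉ S u → S (Function.update u i b) = S u := by
    intro u i b hi
    refine hS _ _ fun j hj => ?_
    rw [Function.update_of_ne]
    rintro rfl
    exact hi hj
  have hf : ∀ i, f i false ≠ f i true := by
    intro i h
    obtain ⟨u, hu⟩ := hno (f i true)
    have := hfS u i
    cases hui : u i <;> rw [hui] at this
    · exact hu (h ▸ this)
    · exact hu this
  have hfb : ∀ i s t, f i s = f i t → s = t := by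
    intro i s t h
    cases s <;> cases t
    · rfl
    · exact absurd h (hf i)
    · exact absurd h.symm (hf i)
    · rfl
  have anti : ∀ u, (S u ∩ S fun i => !u i).card ≤ 2 := by
    intro u
    have := hD u fun i => !u i
    rwa [Finset.filter_true_of_mem (by simp)] at this
  have hfS' : ∀ (u : ι → Bool) i, f i (!u i) ∈ S fun i => !u i := fun u i => hfS (fun i => !u i) i
  set B := univ.filter fun v =>
    2 ≤ (univ.filter fun h : ι × Bool => f h.1 h.2 = v).card with hBdef
  have hB : ∀ v, v ∈ B ↔ 2 ≤ (univ.filter fun h : ι × Bool => f h.1 h.2 = v).card := by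
    intro v
    rw [hBdef, Finset.mem_filter]
    exact and_iff_right (Finset.mem_univ v)
  have hB2 : B.card ≤ 2 := by
    obtain ⟨u, hu⟩ := exists_orientation _ (univ : Finset ι) f rfl
    refine le_trans (Finset.card_le_card fun v hv => ?_) (anti u)
    rw [hB] at hv
    obtain ⟨h₁, m₁, h₂, m₂, hne⟩ := Finset.one_lt_card.mp hv
    simp only [Finset.mem_filter, Finset.mem_univ, true_and] at m₁ m₂
    obtain ⟨⟨i, -, hi⟩, j, -, hj⟩ := hu h₁ h₂ hne (by simp) (by simp) (m₁.trans m₂.symm)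
    rw [m₁] at hi hj
    rw [Finset.mem_inter]
    exact ⟨hi ▸ hfS u i, hj ▸ hfS' u j⟩
  have hM2 : B.card = 2 → (univ.filter fun i => ∀ s, f i s ∈ B).card ≤ 2 := by
    intro hc
    obtain ⟨a, b, hab, hBab⟩ := Finset.card_eq_two.mp hc
    obtain ⟨u, hu⟩ := hno a
    obtain ⟨v, hv⟩ := hno b
    refine le_trans (Finset.card_le_card fun i hi => ?_) (hD u v)
    simp only [Finset.mem_filter, Finset.mem_univ, true_and, hBab, Finset.mem_insert,
      Finset.mem_singleton] at hi
    have onto : ∀ c, c = a ∨ c = b → ∃ s, f i s = c := by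
      intro c hc
      have h0 := hi false
      have h1 := hi true
      have h2 := hf i
      by_contra! h
      have h3 := h false
      have h4 := h true
      grind
    have fixed : ∀ w c, c = a ∨ c = b → c ∉ S w → i ∈ S w := by
      intro w c hc hw
      by_contra hiw
      obtain ⟨s, hs⟩ := onto c hc
      have := hfS (Function.update w i s) i
      rw [flip w i s hiw, Function.update_self, hs] at this
      exact hw this
    simp only [Finset.mem_filter, Finset.mem_inter]
    refine ⟨⟨fixed u a (.inl rfl) hu, fixed v b (.inr rfl) hv⟩, fun huv => ?_⟩
    rcases hi (u i) with h | h
    · exact hu (h ▸ hfS u i)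
    · exact hv (h ▸ huv ▸ hfS v i)
  obtain ⟨hBc, hMc, honto⟩ := card_eq_two_of_edges f hf B hB hB2 hM2
  obtain ⟨p, q, hpq, hM⟩ := Finset.card_eq_two.mp hMc
  have memM : ∀ i, (∀ s, f i s ∈ B) ↔ i = p ∨ i = q := by
    intro i
    simpa only [Finset.mem_filter, Finset.mem_univ, true_and, Finset.mem_insert,
      Finset.mem_singleton] using Finset.ext_iff.mp hM i
  have hp := (memM p).mpr (.inl rfl)
  have hq := (memM q).mpr (.inr rfl)
  have pair : ∀ c c', c ∈ B → c' ∈ B → c ≠ c' → ∀ e ∈ B, e = c ∨ e = c' := by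
    intro c c' hc hc' hne e he
    have : ({c, c'} : Finset ι) = B := Finset.eq_of_subset_of_card_le
      (by simp [Finset.insert_subset_iff, hc, hc'])
      (by rw [Finset.card_pair hne, hBc])
    rw [← this] at he
    simpa using he
  -- If the two edges within `B` are oriented cyclically then `S u` contains no tail outside `B`.
  have cyc : ∀ u, f p (u p) ≠ f q (u q) →
      B ⊆ S u ∧ ∀ i, f i (!u i) ∈ S u → f i (!u i) ∈ B := by
    intro u hu
    have hu' : f p (!u p) ≠ f q (!u q) := by
      intro h
      have h1 := pair _ _ (hp (u p)) (hq (u q)) hu _ (hp (!u p))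
      rcases h1 with h1 | h1
      · simpa using hfb _ _ _ h1
      · simpa using hfb _ _ _ (h.symm.trans h1)
    have hsub : B ⊆ S u ∩ S fun i => !u i := by
      intro e he
      rw [Finset.mem_inter]
      constructor
      · rcases pair _ _ (hp _) (hq _) hu e he with rfl | rfl <;> exact hfS u _
      · rcases pair _ _ (hp _) (hq _) hu' e he with rfl | rfl <;> exact hfS' u _
    have heq := Finset.eq_of_subset_of_card_le hsub (by rw [hBc]; exact anti u)
    refine ⟨fun e he => (Finset.mem_inter.mp (hsub he)).1, fun i hi => ?_⟩
    rw [heq, Finset.mem_inter]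
    exact ⟨hi, hfS' u i⟩
  have hpB : p ∉ B := by
    intro h
    rcases pair _ _ (hp false) (hp true) (hf p) p h with h | h <;> exact hfi _ _ h.symm
  have opposite : ∀ c, ∃ s, f p s ≠ c := by
    intro c
    by_contra! h
    exact hf p ((h false).trans (h true).symm)
  have cover : ∀ j, j ∉ B → j = p ∨ j = q := by
    intro j hj
    by_contra hjM
    obtain ⟨k, s, rfl⟩ := honto j
    have hk : ¬ (k = p ∨ k = q) := fun h => hj ((memM k).mpr h s)
    push Not at hk
    obtain ⟨t, ht⟩ := not_forall.mp fun h => hjM ((memM _).mp h)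
    obtain ⟨r, hr⟩ := opposite (f q false)
    push Not at hjM
    set j := f k s with hjk
    have hkj : k ≠ j := (hfi k s).symm
    let w : Bool → ι → Bool := fun b i =>
      if i = k then !s else if i = p then r else if i = j then b else false
    have wk : ∀ b, w b k = !s := by simp [w]
    have wp : ∀ b, w b p = r := by simp [w, hk.1.symm]
    have wq : ∀ b, w b q = false := by simp [w, hk.2.symm, hpq.symm, hjM.2.symm]
    have wj : ∀ b, w b j = b := by simp [w, hkj.symm, hjM.1]
    have hw : ∀ b, f p (w b p) ≠ f q (w b q) := by intro b; rwa [wp, wq]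
    have hjS : ∀ b, j ∉ S (w b) := by
      intro b h
      have := (cyc _ (hw b)).2 k
      rw [wk, Bool.not_not, ← hjk] at this
      exact hj (this h)
    have hup : S (w t) = S (w !t) := by
      refine hS _ _ fun i hi => ?_
      have : i ≠ j := fun h => hjS (!t) (h ▸ hi)
      simp [w, this]
    have h1 : f j t ∈ S (w t) := by simpa only [wj] using hfS (w t) j
    have h2 := (cyc _ (hw !t)).2 j
    rw [wj, Bool.not_not, ← hup] at h2
    exact ht (h2 h1)
  obtain ⟨k, s, hks⟩ := honto p
  have hkB : k ∈ B := by
    by_contra h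
    exact hpB (hks ▸ (memM k).mpr (cover k h) s)
  obtain ⟨x, hx⟩ := hno k
  set u := Function.update x k (!s) with hu
  have hku : k ∉ S u := by rwa [hu, flip x k _ hx]
  have hpk : p ≠ k := fun h => hpB (h ▸ hkB)
  have hup : f p (u p) ≠ k := fun h => hku (h ▸ hfS u p)
  have huq : f q (u q) ≠ k := fun h => hku (h ▸ hfS u q)
  have hw : f p (!u p) = k := by
    rcases pair _ _ (hp (u p)) hkB hup _ (hp (!u p)) with h | h
    · simpa using hfb _ _ _ h
    · exact h
  set w := Function.update u p (!u p) with hwdef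
  have hcyc := cyc w (by
    rw [hwdef, Function.update_self, Function.update_of_ne hpq.symm, hw]
    exact huq.symm)
  have hpw : p ∉ S w := by
    intro h
    have := hcyc.2 k
    rw [hwdef, Function.update_of_ne hpk.symm, hu, Function.update_self, Bool.not_not, hks] at this
    exact hpB (this h)
  have hback := flip w p (u p) hpw
  rw [hwdef, Function.update_idem, Function.update_eq_self, ← hwdef] at hback
  exact hku (hback ▸ hcyc.1 hkB)

/-- If `S u` is the set of fixed coordinates of the part containing `u` in a partition of the cube
into subcubes, any two parts disagreeing in at most two coordinates, then the partition is trivial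
or some coordinate is fixed in every part. -/
theorem forall_eq_empty_or_exists_forall_mem (n : ℕ) :
    ∀ (ι : Type) [Fintype ι] [DecidableEq ι] (S : (ι → Bool) → Finset ι),
      Fintype.card ι = n →
      (∀ u v, (∀ i ∈ S u, v i = u i) → S v = S u) →
      (∀ u v, ((S u ∩ S v).filter fun i => u i ≠ v i).card ≤ 2) →
      (∀ u, S u = ∅) ∨ ∃ i, ∀ u, i ∈ S u := by
  induction n with
  | zero =>
    intro ι _ _ S hn _ _
    have := Fintype.card_eq_zero_iff.mp hn
    exact .inl fun u => Finset.eq_empty_of_isEmpty _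
  | succ n ih =>
    intro ι _ _ S hn hS hD
    by_contra! hcon
    obtain ⟨⟨u₀, hu₀⟩, hno⟩ := hcon
    have hne : ∀ u, S u ≠ ∅ := by
      intro u hu
      have := hS u u₀ (by simp [hu])
      rw [this, hu] at hu₀
      exact Finset.not_nonempty_empty hu₀
    have key : ∀ i s, ∃ j, j ≠ i ∧ ∀ u, u i = s → j ∈ S u := by
      intro i s
      let ext : ({j // j ≠ i} → Bool) → ι → Bool :=
        fun v j => if h : j = i then s else v ⟨j, h⟩
      have ext_i : ∀ v, ext v i = s := fun v => by simp [ext]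
      have ext_j : ∀ v (j : {j // j ≠ i}), ext v j = v j := fun v j => by simp [ext, j.2]
      have ext_res : ∀ u : ι → Bool, u i = s → ext (u ∘ Subtype.val) = u := by
        intro u hu
        funext j
        by_cases h : j = i
        · rw [h, ext_i, hu]
        · simp [ext, h]
      let T : ({j // j ≠ i} → Bool) → Finset {j // j ≠ i} :=
        fun v => univ.filter fun j => (j : ι) ∈ S (ext v)
      have memT : ∀ v j, j ∈ T v ↔ (j : ι) ∈ S (ext v) := fun v j => by simp [T]
      have hT : ∀ u v, (∀ j ∈ T u, v j = u j) → T v = T u := by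
        intro u v huv
        have : S (ext v) = S (ext u) := hS _ _ fun j hj => by
          by_cases h : j = i
          · rw [h, ext_i, ext_i]
          · have := huv ⟨j, h⟩ ((memT _ _).mpr hj)
            simpa [ext, h] using this
        simp only [T, this]
      have hTD : ∀ u v, ((T u ∩ T v).filter fun j => u j ≠ v j).card ≤ 2 := by
        intro u v
        refine le_trans ?_ (hD (ext u) (ext v))
        refine Finset.card_le_card_of_injOn Subtype.val ?_ Subtype.val_injective.injOn
        intro j hj
        simp only [Finset.coe_filter, Finset.mem_inter, memT, Set.mem_ofPred_eq] at hj ⊢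
        rwa [ext_j, ext_j]
      rcases ih {j // j ≠ i} T (by simp [Fintype.card_subtype_compl, hn]) hT hTD with
        h | ⟨j, hj⟩
      · exfalso
        obtain ⟨w, hw⟩ := hno i
        set u := Function.update w i s with hu
        have hui : u i = s := by simp [hu]
        have h1 := h (u ∘ Subtype.val)
        have h2 : S u = S w := hS w u fun j hj => by
          rw [hu, Function.update_of_ne]
          rintro rfl
          exact hw hj
        obtain ⟨j, hj⟩ := Finset.nonempty_iff_ne_empty.mpr (hne u)
        have hji : j ≠ i := fun h => hw (h2 ▸ h ▸ hj)
        have := Finset.ext_iff.mp h1 ⟨j, hji⟩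
        rw [memT, ext_res u hui] at this
        exact Finset.notMem_empty _ (this.mp hj)
      · refine ⟨j, j.2, fun u hu => ?_⟩
        have := hj (u ∘ Subtype.val)
        rwa [memT, ext_res u hu] at this
    choose f hfi hfS using key
    have : Nonempty ι := ⟨hu₀.choose⟩
    obtain ⟨i, hi⟩ := exists_forall_mem_of_halves S hS hD f hfi fun u i => hfS i _ u rfl
    obtain ⟨u, hu⟩ := hno i
    exact hu (hi u)

theorem mem_Hcube {d : ℕ} {x : Fin d → Option Bool} {u : Fin d → Bool} :
    u ∈ Hcube x ↔ ∀ i b, x i = some b → u i = b := by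
  simp [Hcube]

theorem Hcube_nonempty {d : ℕ} (x : Fin d → Option Bool) : (Hcube x).Nonempty :=
  ⟨fun i => (x i).getD false, mem_Hcube.mpr fun i b h => by simp [h]⟩

theorem stmt_17 {d : ℕ} (F : Finset (Fin d → Option Bool))
    (hF : Nbly 2 F)
    (hdisj : ∀ x ∈ F, ∀ y ∈ F, x ≠ y → Disjoint (Hcube x) (Hcube y))
    (hcover : ∀ u : Fin d → Bool, ∃ x ∈ F, u ∈ Hcube x)
    (hcard : 2 ≤ F.card) :
    ∃ i : Fin d, ∀ x ∈ F, x i ≠ none := by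
  choose X hXF hX using hcover
  have uniq : ∀ x ∈ F, ∀ u ∈ Hcube x, X u = x := by
    intro x hx u hu
    by_contra h
    exact Finset.disjoint_left.mp (hdisj _ (hXF u) _ hx h) (hX u) hu
  let S : (Fin d → Bool) → Finset (Fin d) := fun u => univ.filter fun i => X u i ≠ none
  have memS : ∀ u i, i ∈ S u ↔ X u i ≠ none := fun u i => by simp [S]
  have hS : ∀ u v, (∀ i ∈ S u, v i = u i) → S v = S u := by
    intro u v huv
    have : X v = X u := uniq _ (hXF u) _ (mem_Hcube.mpr fun i b hb => by
      rw [huv i ((memS _ _).mpr (by simp [hb])), mem_Hcube.mp (hX u) i b hb])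
    simp only [S, this]
  have hD : ∀ u v, ((S u ∩ S v).filter fun i => u i ≠ v i).card ≤ 2 := by
    intro u v
    have val : ∀ w i, X w i ≠ none → X w i = some (w i) := by
      intro w i hi
      obtain ⟨b, hb⟩ := Option.ne_none_iff_exists'.mp hi
      rw [hb, mem_Hcube.mp (hX w) i b hb]
    by_cases hXY : X u = X v
    · rw [Finset.filter_false_of_mem]
      · simp
      · intro i hi
        simp only [Finset.mem_inter, memS] at hi
        have h1 := val u i hi.1
        rw [hXY, val v i hi.2] at h1
        simpa using h1.symm
    · refine le_trans (Finset.card_le_card fun i hi => ?_) (hF _ (hXF u) _ (hXF v) hXY).2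
      simp only [Finset.mem_inter, Finset.mem_filter, Finset.mem_univ, true_and, memS] at hi ⊢
      refine ⟨u i, val u i hi.1.1, ?_⟩
      rw [val v i hi.1.2, Option.some_inj]
      exact Bool.eq_not_of_ne hi.2.symm
  rcases forall_eq_empty_or_exists_forall_mem _ (Fin d) S rfl hS hD with h | ⟨i, hi⟩
  · exfalso
    obtain ⟨x, hx, y, hy, hxy⟩ := Finset.one_lt_card.mp hcard
    have triv : ∀ z ∈ F, z = fun _ => none := by
      intro z hz
      obtain ⟨u, hu⟩ := Hcube_nonempty z
      funext i
      by_contra hi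
      rw [← uniq z hz u hu, ← ne_eq, ← memS, h u] at hi
      exact Finset.notMem_empty _ hi
    exact hxy ((triv x hx).trans (triv y hy).symm)
  · refine ⟨i, fun x hx => ?_⟩
    obtain ⟨u, hu⟩ := Hcube_nonempty x
    rw [← uniq x hx u hu, ← memS]
    exact hi u
end
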